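/- Let g ≡ 0 (mod 3), s ≡ 2 or 4 (mod 6), λ ∈ {1,3,5}, a,n positive integers, u = 2ag + s, and v = 2agn + s. Suppose that: there exists a g-PCS_2^e((2ag)^n : s) for every integer e with 0 ≤ e ≤ ag(n−1) and e ≡ 0 (mod 3a); (i) there exists a simple S_6(2,3,u) on a u-set X no block of which is contained in a fixed s-subset Y of X; and (ii) there exists an NWBTS(u;c) for every integer c of the form c = (λ·binom(u,2) + δ)/3 with δ an integer, −u/2 < δ < u/2. Then for every integer q with 0 ≤ q ≤ n−1 and every integer b′ with 3b′ = λ·binom(v,2) + ε for some integer ε with −v/2 < ε < v/2, there exists an NWBTS(v;b) with b = q·v(v−1) + b′. -/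

import Mathlib

namespace DataPlacement

open Finset

variable {α : Type*} [DecidableEq α]

/-- Number of blocks of the family `F` (with multiplicity) containing `T`. -/
def lamF (F : Multiset (Finset α)) (T : Finset α) : ℕ :=
  Multiset.card (F.filter fun B => T ⊆ B)

/-- Triple system with `b` blocks on a point set `X` of size `v`. -/
def IsTSOn (X : Finset α) (v b : ℕ) (F : Multiset (Finset α)) : Prop :=
  X.card = v ∧ Multiset.card F = b ∧ ∀ B ∈ F, B.card = 3 ∧ B ⊆ X

/-- `(l, e)` is the pair associated with `(v, b)`:
`3b = l·v(v−1)/2 + e` with `−v/2 < e < v/2`. -/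
def AssocPair (v b l : ℕ) (e : ℤ) : Prop :=
  6 * (b : ℤ) = (l : ℤ) * v * ((v : ℤ) - 1) + 2 * e ∧
    -(v : ℤ) < 2 * e ∧ 2 * e < (v : ℤ)

/-- Condition (C1). -/
def CondC1 (v b : ℕ) : Prop :=
  v % 3 = 2 ∧ ∃ l : ℕ, 0 < l ∧
    ((v % 6 = 5 ∧ (l % 3 = 1 ∨ l % 3 = 2)) ∨
     (v % 6 = 2 ∧ (l % 6 = 2 ∨ l % 6 = 4))) ∧
    (b = l * v * (v - 1) / 6 ∨ b = (l * v * (v - 1) + 5) / 6)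

/-- Condition (C2). -/
def CondC2 (v b : ℕ) : Prop :=
  v % 2 = 0 ∧ ∃ l : ℕ, 0 < l ∧ l % 2 = 1 ∧
    (l : ℤ) * v * ((v : ℤ) - 1) - v < 6 * (b : ℤ) ∧
    6 * (b : ℤ) < (l : ℤ) * v * ((v : ℤ) - 1) + v

/-- Pairs of points of `X` whose block count equals `l + i`. -/
def Dlev (X : Finset α) (F : Multiset (Finset α)) (l : ℕ) (i : ℤ) :
    Finset (Finset α) :=
  (X.powersetCard 2).filter fun p => (lamF F p : ℤ) = (l : ℤ) + i

/-- Every pair of points of `X` lies in `l−1`, `l`, or `l+1` blocks. -/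
def PairRangeOn (X : Finset α) (F : Multiset (Finset α)) (l : ℕ) : Prop :=
  ∀ p ∈ X.powersetCard 2,
    (l : ℤ) - 1 ≤ (lamF F p : ℤ) ∧ (lamF F p : ℤ) ≤ (l : ℤ) + 1

def IsTriangle (D : Finset (Finset α)) : Prop :=
  ∃ x y z : α, x ≠ y ∧ x ≠ z ∧ y ≠ z ∧
    D = {({x, y} : Finset α), {y, z}, {x, z}}

def IsFourCycle (D : Finset (Finset α)) : Prop :=
  ∃ x y z w : α, x ≠ y ∧ x ≠ z ∧ x ≠ w ∧ y ≠ z ∧ y ≠ w ∧ z ≠ w ∧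
    D = {({x, y} : Finset α), {y, z}, {z, w}, {x, w}}

/-- `D` is a perfect matching on the point set `X`. -/
def IsPerfectMatchingOn (X : Finset α) (D : Finset (Finset α)) : Prop :=
  (∀ p ∈ D, p.card = 2 ∧ p ⊆ X) ∧ ∀ x ∈ X, ∃! p, p ∈ D ∧ x ∈ p

/-- Defect-graph shape required for nearly 2-balance under (C1). -/
def C1ShapeOn (X : Finset α) (F : Multiset (Finset α)) (l : ℕ) (e : ℤ) : Prop :=
  (e = 1 ∧ IsTriangle (Dlev X F l 1 ∪ Dlev X F l (-1)) ∧
     (Dlev X F l 1).card = 2 ∧ (Dlev X F l (-1)).card = 1) ∨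
  (e = -1 ∧ IsTriangle (Dlev X F l 1 ∪ Dlev X F l (-1)) ∧
     (Dlev X F l 1).card = 1 ∧ (Dlev X F l (-1)).card = 2) ∨
  (e = 2 ∧ IsFourCycle (Dlev X F l 1 ∪ Dlev X F l (-1)) ∧
     (Dlev X F l 1).card = 3 ∧ (Dlev X F l (-1)).card = 1) ∨
  (e = -2 ∧ IsFourCycle (Dlev X F l 1 ∪ Dlev X F l (-1)) ∧
     (Dlev X F l 1).card = 1 ∧ (Dlev X F l (-1)).card = 3)

/-- Defect-graph shape required for nearly 2-balance under (C2)
(here `v = X.card`). -/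
def C2ShapeOn (X : Finset α) (v : ℕ) (F : Multiset (Finset α)) (l : ℕ) (e : ℤ) : Prop :=
  (((v : ℤ) - 2 * e) % 4 = 0 ∧
    IsPerfectMatchingOn X (Dlev X F l 1 ∪ Dlev X F l (-1)) ∧
    4 * ((Dlev X F l 1).card : ℤ) = (v : ℤ) + 2 * e ∧
    4 * ((Dlev X F l (-1)).card : ℤ) = (v : ℤ) - 2 * e) ∨
  (((v : ℤ) - 2 * e) % 4 ≠ 0 ∧
    ∃ (c a₂ a₃ a₄ : α) (star : Finset (Finset α)),
      c ∈ X ∧ a₂ ∈ X ∧ a₃ ∈ X ∧ a₄ ∈ X ∧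
      c ≠ a₂ ∧ c ≠ a₃ ∧ c ≠ a₄ ∧ a₂ ≠ a₃ ∧ a₂ ≠ a₄ ∧ a₃ ≠ a₄ ∧
      star = {({c, a₂} : Finset α), {c, a₃}, {c, a₄}} ∧
      star ⊆ Dlev X F l 1 ∪ Dlev X F l (-1) ∧
      IsPerfectMatchingOn (X \ {c, a₂, a₃, a₄})
        ((Dlev X F l 1 ∪ Dlev X F l (-1)) \ star) ∧
      (((star ∩ Dlev X F l 1).card = 2 ∧ (star ∩ Dlev X F l (-1)).card = 1 ∧
          4 * (((Dlev X F l 1) \ star).card : ℤ) = (v : ℤ) - 6 + 2 * e ∧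
          4 * (((Dlev X F l (-1)) \ star).card : ℤ) = (v : ℤ) - 2 - 2 * e) ∨
        ((star ∩ Dlev X F l 1).card = 1 ∧ (star ∩ Dlev X F l (-1)).card = 2 ∧
          4 * (((Dlev X F l 1) \ star).card : ℤ) = (v : ℤ) - 2 + 2 * e ∧
          4 * (((Dlev X F l (-1)) \ star).card : ℤ) = (v : ℤ) - 6 - 2 * e)))

/-- `F` is 3-balanced on `X`: the multiplicities of any two triples of `X`
differ by at most one. -/
def ThreeBalancedOn (X : Finset α) (F : Multiset (Finset α)) : Prop :=
  ∀ T₁ ∈ X.powersetCard 3, ∀ T₂ ∈ X.powersetCard 3, F.count T₁ ≤ F.count T₂ + 1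

/-- Nearly well-balanced triple system NWBTS(v;b) on the point set `X`. -/
def IsNWBTSOn (X : Finset α) (v b : ℕ) (F : Multiset (Finset α)) : Prop :=
  IsTSOn X v b F ∧ ThreeBalancedOn X F ∧
  ∃ (l : ℕ) (e : ℤ), 0 < l ∧ AssocPair v b l e ∧ PairRangeOn X F l ∧
    ((CondC1 v b ∧ C1ShapeOn X F l e) ∨ (CondC2 v b ∧ C2ShapeOn X v F l e))

/-- `B` is an S_mu(2,3,·) design on the point set `X`. -/
def IsSDesignOn (X : Finset α) (mu : ℕ) (B : Multiset (Finset α)) : Prop :=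
  (∀ A ∈ B, A.card = 3 ∧ A ⊆ X) ∧ ∀ p ∈ X.powersetCard 2, lamF B p = mu

/-- `B` is a GDD_mu(2,3,·) of type `1^{·}u^1` on `X` with long group `U`. -/
def IsGDD1u (X : Finset α) (mu u : ℕ) (U : Finset α) (B : Multiset (Finset α)) : Prop :=
  U ⊆ X ∧ U.card = u ∧
  (∀ A ∈ B, A.card = 3 ∧ A ⊆ X ∧ (A ∩ U).card ≤ 1) ∧
  ∀ p ∈ X.powersetCard 2, ¬ p ⊆ U → lamF B p = mu

/-- `B` is a GDD_mu(2,3,·) with group family `G`. -/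
def IsGDDgroups (mu : ℕ) {n : ℕ} (G : Fin n → Finset α) (B : Multiset (Finset α)) : Prop :=
  (∀ A ∈ B, A.card = 3 ∧ A ⊆ Finset.univ.biUnion G ∧ ∀ i, (A ∩ G i).card ≤ 1) ∧
  ∀ x y : α, x ≠ y → (∃ i j, i ≠ j ∧ x ∈ G i ∧ y ∈ G j) → lamF B {x, y} = mu

/-- Nearly group divisible design NGDD(2,3,·) of type `2^{(m,n)}u^1` on `X`. -/
def IsNGDD (X : Finset α) (m n u : ℕ) (G : Fin (m + n) → Finset α) (U : Finset α)
    (B : Multiset (Finset α)) : Prop :=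
  (∀ i, (G i).card = 2 ∧ G i ⊆ X) ∧ U.card = u ∧ U ⊆ X ∧
  (∀ i j, i ≠ j → Disjoint (G i) (G j)) ∧ (∀ i, Disjoint (G i) U) ∧
  U ∪ Finset.univ.biUnion G = X ∧
  (∀ A ∈ B, A.card = 3 ∧ A ⊆ X) ∧
  (∀ i : Fin (m + n), (i : ℕ) < m → lamF B (G i) = 2) ∧
  (∀ i : Fin (m + n), m ≤ (i : ℕ) → lamF B (G i) = 0) ∧
  (∀ p ∈ U.powersetCard 2, lamF B p = 0) ∧
  (∀ p ∈ X.powersetCard 2, (∀ i, ¬ p ⊆ G i) → ¬ p ⊆ U → lamF B p = 1)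

/-- Candelabra system CS(g^n : s) on `X` with stem `S` and groups `G`. -/
def IsCS (X : Finset α) (g n s : ℕ) (S : Finset α) (G : Fin n → Finset α)
    (A : Multiset (Finset α)) : Prop :=
  S.card = s ∧ S ⊆ X ∧ (∀ i, (G i).card = g ∧ G i ⊆ X) ∧
  (∀ i j, i ≠ j → Disjoint (G i) (G j)) ∧ (∀ i, Disjoint (G i) S) ∧
  S ∪ Finset.univ.biUnion G = X ∧
  (∀ B ∈ A, B.card = 3 ∧ B ⊆ X) ∧
  (∀ T ∈ X.powersetCard 3, (∀ i, ¬ T ⊆ S ∪ G i) → lamF A T = 1) ∧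
  (∀ T ∈ X.powersetCard 3, (∃ i, T ⊆ S ∪ G i) → lamF A T = 0)

/-- Partitionable candelabra system PCS(g^n : s). -/
def IsPCS (X : Finset α) (g n s : ℕ) (S : Finset α) (G : Fin n → Finset α)
    (A : Multiset (Finset α)) : Prop :=
  IsCS X g n s S G A ∧
  ∃ (Ax : α → Multiset (Finset α)) (Ai : Fin (s - 2) → Multiset (Finset α)),
    A = (∑ p ∈ X \ S, Ax p) + ∑ i, Ai i ∧
    (∀ i : Fin n, ∀ p ∈ G i, IsGDD1u X 1 (g + s) (G i ∪ S) (Ax p)) ∧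
    (∀ j, IsGDDgroups 1 G (Ai j))

/-- g-PCS_2((2ag)^n : s). -/
def IsGPCS2 (X : Finset α) (a g n s : ℕ) (S : Finset α) (G : Fin n → Finset α)
    (A : Multiset (Finset α)) : Prop :=
  IsCS X (2 * a * g) n s S G A ∧
  ∃ (P : Fin (g * n) → Multiset (Finset α)) (grp : Fin (g * n) → Fin n),
    (∑ i, P i) ≤ A ∧
    (∀ j : Fin n, (Finset.univ.filter fun i => grp i = j).card = g) ∧
    (∀ i, IsGDD1u X 2 (2 * a * g + s) (G (grp i) ∪ S) (P i))

/-- g-PCS_2^r((2ag)^n : s). -/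
def IsGPCS2r (X : Finset α) (a g n s r : ℕ) (S : Finset α) (G : Fin n → Finset α)
    (A : Multiset (Finset α)) : Prop :=
  IsCS X (2 * a * g) n s S G A ∧
  ∃ (P : Fin (g * n) → Multiset (Finset α)) (grp : Fin (g * n) → Fin n),
    (∑ i, P i) ≤ A ∧
    (∀ j : Fin n, (Finset.univ.filter fun i => grp i = j).card = g) ∧
    (∀ i, IsGDD1u X 2 (2 * a * g + s) (G (grp i) ∪ S) (P i)) ∧
    ∃ (i : Fin (g * n)) (N : Multiset (Finset α))
      (Gs : Fin (r + (a * g * (n - 1) - r)) → Finset α),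
      N ≤ P i ∧ IsNGDD X r (a * g * (n - 1) - r) (2 * a * g + s) Gs (G (grp i) ∪ S) N

/-- GDD(3,3,·) of type `g^k` on `X` with groups `H`. -/
def IsGDD3On (X : Finset α) (g : ℕ) {k : ℕ} (H : Fin k → Finset α)
    (A : Multiset (Finset α)) : Prop :=
  (∀ i, (H i).card = g ∧ H i ⊆ X) ∧ (∀ i j, i ≠ j → Disjoint (H i) (H j)) ∧
  Finset.univ.biUnion H = X ∧
  (∀ B ∈ A, B.card = 3 ∧ B ⊆ X ∧ ∀ i, (B ∩ H i).card ≤ 1) ∧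
  (∀ T ∈ X.powersetCard 3, (∀ i, (T ∩ H i).card ≤ 1) → lamF A T = 1)

/-- `B` is a GDD_mu(2,3,·) on the points not in the omitted group `H o`,
with group set `{H i : i ≠ o}`. -/
def IsGDDOmit (mu : ℕ) {k : ℕ} (H : Fin k → Finset α) (o : Fin k)
    (B : Multiset (Finset α)) : Prop :=
  (∀ A ∈ B, A.card = 3 ∧ Disjoint A (H o) ∧ ∀ i, (A ∩ H i).card ≤ 1) ∧
  ∀ x y : α, x ≠ y →
    (∃ i j, i ≠ j ∧ i ≠ o ∧ j ≠ o ∧ x ∈ H i ∧ y ∈ H j) → lamF B {x, y} = mu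

/-- PGDD_2((2g)^{n+1}). -/
def IsPGDD2 (g n : ℕ) (H : Fin (n + 1) → Finset (Fin (2 * g * (n + 1))))
    (A : Multiset (Finset (Fin (2 * g * (n + 1))))) : Prop :=
  IsGDD3On Finset.univ (2 * g) H A ∧
  ∃ (i0 : Fin (n + 1))
    (P : Fin (g * n + 2 * g) → Multiset (Finset (Fin (2 * g * (n + 1)))))
    (f : Fin (g * n + 2 * g) → Fin (n + 1)),
    A = ∑ i, P i ∧
    (∀ j, j ≠ i0 → (Finset.univ.filter fun i => f i = j).card = g) ∧
    (∀ i, f i ≠ i0 → IsGDDOmit 2 H (f i) (P i)) ∧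
    (∀ i, f i = i0 → IsGDDOmit 1 H i0 (P i))

/-- 1-FG(3,(K1,KT),n) of type 1^n. -/
def Is1FG (n : ℕ) (K1 KT : Set ℕ) (A1 AT : Multiset (Finset (Fin n))) : Prop :=
  (∀ B ∈ A1, B.card ∈ K1) ∧ (∀ B ∈ AT, B.card ∈ KT) ∧
  (∀ p ∈ (Finset.univ : Finset (Fin n)).powersetCard 2, lamF A1 p = 1) ∧
  (∀ T ∈ (Finset.univ : Finset (Fin n)).powersetCard 3, lamF (A1 + AT) T = 1)

/-- PICS_2^r((2g)^3 : 0). -/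
def IsPICS2 (g r : ℕ) (G : Fin 3 → Finset (Fin (6 * g)))
    (A : Multiset (Finset (Fin (6 * g)))) : Prop :=
  IsCS Finset.univ (2 * g) 3 0 (∅ : Finset (Fin (6 * g))) G A ∧
  ∃ P : Fin (4 * g - 2) → Multiset (Finset (Fin (6 * g))),
    A = ∑ i, P i ∧
    (∀ i : Fin (4 * g - 2), (i : ℕ) < 2 * g → IsSDesignOn Finset.univ 2 (P i)) ∧
    (∃ i : Fin (4 * g - 2), (i : ℕ) < 2 * g ∧
      ∃ (N : Multiset (Finset (Fin (6 * g))))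
        (Gs : Fin (r + (3 * g - r)) → Finset (Fin (6 * g))),
        N ≤ P i ∧ IsNGDD Finset.univ r (3 * g - r) 0 Gs ∅ N) ∧
    (∀ i : Fin (4 * g - 2), 2 * g ≤ (i : ℕ) → IsGDDgroups 1 G (P i))

/-- Number of ordered pairs of blocks of `F` whose intersection has exactly
`j` points. -/
def interCount (F : Multiset (Finset α)) (j : ℕ) : ℕ :=
  Multiset.card
    ((F.bind fun A => F.map fun B => (A, B)).filter fun p => (p.1 ∩ p.2).card = j)

/-- The polynomial `P(F, x) = Σ_{j=0}^{3} v_j x^j`. -/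
noncomputable def Pval (F : Multiset (Finset α)) (x : ℝ) : ℝ :=
  ∑ j ∈ Finset.range 4, (interCount F j : ℝ) * x ^ j

/-- Optimal data placement for triple replication. -/
def IsOptimalDP (v b : ℕ) (F : Multiset (Finset (Fin v))) : Prop :=
  IsTSOn Finset.univ v b F ∧
  ∀ F' : Multiset (Finset (Fin v)), IsTSOn Finset.univ v b F' →
    ∀ x : ℝ, 1 ≤ x → Pval F x ≤ Pval F' x

section Helpers

variable {β : Type*} [DecidableEq β]

/-- The map on finsets induced by an embedding, as an embedding. -/
def fmap (f : α ↪ β) : Finset α ↪ Finset β := (Finset.mapEmbedding f).toEmbedding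

lemma fmap_apply (f : α ↪ β) (p : Finset α) : fmap f p = p.map f := rfl

lemma lamF_add (F H : Multiset (Finset α)) (T : Finset α) :
    lamF (F + H) T = lamF F T + lamF H T := by
  simp [lamF]

lemma lamF_sum {ι : Type*} (s : Finset ι) (P : ι → Multiset (Finset α)) (T : Finset α) :
    lamF (∑ i ∈ s, P i) T = ∑ i ∈ s, lamF (P i) T := by
  classical
  induction s using Finset.induction_on with
  | empty => simp [lamF]
  | insert i s hi ih => rw [Finset.sum_insert hi, Finset.sum_insert hi, lamF_add, ih]

lemma lamF_cons (B : Finset α) (F : Multiset (Finset α)) (T : Finset α) :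
    lamF (B ::ₘ F) T = lamF F T + if T ⊆ B then 1 else 0 := by
  unfold lamF
  by_cases h : T ⊆ B <;> simp [h]

lemma lamF_eq_zero {F : Multiset (Finset α)} {T : Finset α} (h : ∀ B ∈ F, ¬ T ⊆ B) :
    lamF F T = 0 := by
  unfold lamF
  rw [Multiset.card_eq_zero, Multiset.filter_eq_nil]
  exact h

lemma lamF_map (f : α ↪ β) (F : Multiset (Finset α)) (p : Finset α) :
    lamF (F.map (fmap f)) (p.map f) = lamF F p := by
  induction F using Multiset.induction_on with
  | empty => simp [lamF]
  | cons B F ih =>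
    rw [Multiset.map_cons, lamF_cons, lamF_cons, ih, fmap_apply]
    simp [Finset.map_subset_map]

lemma lamF_eq_count {F : Multiset (Finset α)} {T : Finset α} {k : ℕ}
    (h : ∀ B ∈ F, B.card = k) (hT : T.card = k) : lamF F T = F.count T := by
  unfold lamF
  rw [Multiset.count_eq_card_filter_eq]
  congr 1
  apply Multiset.filter_congr
  intro B hB
  constructor
  · intro hs
    exact Finset.eq_of_subset_of_card_le hs (by rw [h B hB, hT])
  · rintro rfl
    exact Finset.Subset.refl _

lemma sum_lamF {X : Finset α} {F : Multiset (Finset α)}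
    (h : ∀ B ∈ F, B.card = 3 ∧ B ⊆ X) :
    ∑ p ∈ X.powersetCard 2, lamF F p = 3 * Multiset.card F := by
  induction F using Multiset.induction_on with
  | empty => simp [lamF]
  | cons B F ih =>
    have hB := h B (Multiset.mem_cons_self B F)
    have ih' := ih (fun C hC => h C (Multiset.mem_cons_of_mem hC))
    simp only [lamF_cons, Finset.sum_add_distrib, ih', Multiset.card_cons]
    have : (X.powersetCard 2).filter (fun p => p ⊆ B) = B.powersetCard 2 := by
      ext p
      simp only [Finset.mem_filter, Finset.mem_powersetCard]
      constructor
      · rintro ⟨⟨_, h2⟩, h3⟩; exact ⟨h3, h2⟩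
      · rintro ⟨h1, h2⟩; exact ⟨⟨h1.trans hB.2, h2⟩, h1⟩
    rw [← Finset.sum_filter, this, Finset.sum_const, Finset.card_powersetCard, hB.1]
    simp [Nat.choose]
    ring

lemma sum_lamF_range {X : Finset α} {F : Multiset (Finset α)} {l : ℕ}
    (h : PairRangeOn X F l) :
    (∑ p ∈ X.powersetCard 2, (lamF F p : ℤ)) =
      (l : ℤ) * (X.card.choose 2 : ℤ) + (Dlev X F l 1).card - (Dlev X F l (-1)).card := by
  have h1 : ∀ p ∈ X.powersetCard 2, (lamF F p : ℤ) = (l : ℤ) +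
      ((if (lamF F p : ℤ) = (l : ℤ) + 1 then 1 else 0) -
      (if (lamF F p : ℤ) = (l : ℤ) + (-1) then 1 else 0)) := by
    intro p hp
    have := h p hp
    split_ifs <;> omega
  rw [Finset.sum_congr rfl h1, Finset.sum_add_distrib, Finset.sum_sub_distrib]
  simp only [Finset.sum_const, Finset.card_powersetCard, Finset.sum_boole, Dlev]
  simp
  ring

lemma two_choose_two (m : ℕ) : 2 * (m.choose 2 : ℤ) = (m : ℤ) * ((m : ℤ) - 1) := by
  induction m with
  | zero => simp
  | succ k ih =>
    rw [Nat.choose_succ_succ' k 1, Nat.choose_one_right]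
    push_cast
    linarith

lemma six_choose_three (m : ℕ) :
    6 * (m.choose 3 : ℤ) = (m : ℤ) * ((m : ℤ) - 1) * ((m : ℤ) - 2) := by
  induction m with
  | zero => simp
  | succ k ih =>
    rw [Nat.choose_succ_succ' k 2]
    push_cast
    have := two_choose_two k
    linarith

/-- The shape of `C2ShapeOn` for arbitrary sets of pairs. -/
def Shp (X : Finset α) (v : ℕ) (e : ℤ) (D M : Finset (Finset α)) : Prop :=
  (((v : ℤ) - 2 * e) % 4 = 0 ∧
    IsPerfectMatchingOn X (D ∪ M) ∧
    4 * (D.card : ℤ) = (v : ℤ) + 2 * e ∧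
    4 * (M.card : ℤ) = (v : ℤ) - 2 * e) ∨
  (((v : ℤ) - 2 * e) % 4 ≠ 0 ∧
    ∃ (c a₂ a₃ a₄ : α) (star : Finset (Finset α)),
      c ∈ X ∧ a₂ ∈ X ∧ a₃ ∈ X ∧ a₄ ∈ X ∧
      c ≠ a₂ ∧ c ≠ a₃ ∧ c ≠ a₄ ∧ a₂ ≠ a₃ ∧ a₂ ≠ a₄ ∧ a₃ ≠ a₄ ∧
      star = {({c, a₂} : Finset α), {c, a₃}, {c, a₄}} ∧
      star ⊆ D ∪ M ∧
      IsPerfectMatchingOn (X \ {c, a₂, a₃, a₄}) ((D ∪ M) \ star) ∧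
      (((star ∩ D).card = 2 ∧ (star ∩ M).card = 1 ∧
          4 * ((D \ star).card : ℤ) = (v : ℤ) - 6 + 2 * e ∧
          4 * ((M \ star).card : ℤ) = (v : ℤ) - 2 - 2 * e) ∨
        ((star ∩ D).card = 1 ∧ (star ∩ M).card = 2 ∧
          4 * ((D \ star).card : ℤ) = (v : ℤ) - 2 + 2 * e ∧
          4 * ((M \ star).card : ℤ) = (v : ℤ) - 6 - 2 * e)))

lemma Shp_card {X : Finset α} {v : ℕ} {e : ℤ} {D M : Finset (Finset α)}
    (h : Shp X v e D M) : (D.card : ℤ) - M.card = e := by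
  rcases h with ⟨_, _, h1, h2⟩ | ⟨_, c, a₂, a₃, a₄, star, _, _, _, _, _, _, _, _, _, _, _, _, _, h⟩
  · omega
  · have e1 := Finset.card_sdiff_add_card_inter D star
    have e2 := Finset.card_sdiff_add_card_inter M star
    rw [Finset.inter_comm] at e1 e2
    rcases h with ⟨h1, h2, h3, h4⟩ | ⟨h1, h2, h3, h4⟩ <;> omega

lemma pm_map (f : α ↪ β) {X : Finset α} {D : Finset (Finset α)}
    (h : IsPerfectMatchingOn X D) :
    IsPerfectMatchingOn (X.map f) (D.map (fmap f)) := by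
  refine ⟨?_, ?_⟩
  · intro p hp
    obtain ⟨p', hp', rfl⟩ := Finset.mem_map.1 hp
    rw [fmap_apply, Finset.card_map]
    exact ⟨(h.1 p' hp').1, Finset.map_subset_map.2 (h.1 p' hp').2⟩
  · intro x hx
    obtain ⟨x', hx', rfl⟩ := Finset.mem_map.1 hx
    obtain ⟨p, ⟨hp1, hp2⟩, hp3⟩ := h.2 x' hx'
    refine ⟨p.map f, ⟨Finset.mem_map.2 ⟨p, hp1, rfl⟩, Finset.mem_map_of_mem f hp2⟩, ?_⟩
    rintro r ⟨hr1, hr2⟩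
    obtain ⟨r', hr', rfl⟩ := Finset.mem_map.1 hr1
    rw [fmap_apply] at hr2 ⊢
    rw [hp3 r' ⟨hr', (Finset.mem_map' f).1 hr2⟩]

lemma pm_union {U W : Finset α} (hd : Disjoint U W) {D M : Finset (Finset α)}
    (h : IsPerfectMatchingOn U D) (h' : IsPerfectMatchingOn W M) :
    IsPerfectMatchingOn (U ∪ W) (D ∪ M) := by
  refine ⟨?_, ?_⟩
  · intro p hp
    rcases Finset.mem_union.1 hp with hp | hp
    · exact ⟨(h.1 p hp).1, (h.1 p hp).2.trans Finset.subset_union_left⟩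
    · exact ⟨(h'.1 p hp).1, (h'.1 p hp).2.trans Finset.subset_union_right⟩
  · intro x hx
    rcases Finset.mem_union.1 hx with hx | hx
    · obtain ⟨p, ⟨hp1, hp2⟩, hp3⟩ := h.2 x hx
      refine ⟨p, ⟨Finset.mem_union_left _ hp1, hp2⟩, ?_⟩
      rintro r ⟨hr1, hr2⟩
      rcases Finset.mem_union.1 hr1 with hr | hr
      · exact hp3 r ⟨hr, hr2⟩
      · exact absurd ((h'.1 r hr).2 hr2) (Finset.disjoint_left.1 hd hx)
    · obtain ⟨p, ⟨hp1, hp2⟩, hp3⟩ := h'.2 x hx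
      refine ⟨p, ⟨Finset.mem_union_right _ hp1, hp2⟩, ?_⟩
      rintro r ⟨hr1, hr2⟩
      rcases Finset.mem_union.1 hr1 with hr | hr
      · exact absurd hx (Finset.disjoint_left.1 hd ((h.1 r hr).2 hr2))
      · exact hp3 r ⟨hr, hr2⟩

lemma Shp_map (f : α ↪ β) {X : Finset α} {v : ℕ} {e : ℤ} {D M : Finset (Finset α)}
    (h : Shp X v e D M) : Shp (X.map f) v e (D.map (fmap f)) (M.map (fmap f)) := by
  rcases h with ⟨h0, h1, h2, h3⟩ | ⟨h0, c, a₂, a₃, a₄, star, hc, h2, h3, h4, n1, n2, n3, n4, n5, n6,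
    hst, hsub, hpm, hh⟩
  · left
    refine ⟨h0, ?_, by simpa using h2, by simpa using h3⟩
    rw [← Finset.map_union]
    exact pm_map f h1
  · right
    refine ⟨h0, f c, f a₂, f a₃, f a₄, star.map (fmap f), Finset.mem_map_of_mem f hc,
      Finset.mem_map_of_mem f h2, Finset.mem_map_of_mem f h3, Finset.mem_map_of_mem f h4,
      f.injective.ne n1, f.injective.ne n2, f.injective.ne n3, f.injective.ne n4,
      f.injective.ne n5, f.injective.ne n6, ?_, ?_, ?_, ?_⟩
    · subst hst
      simp [fmap_apply, Finset.map_insert]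
    · rw [← Finset.map_union]
      exact Finset.map_subset_map.2 hsub
    · have := pm_map f hpm
      rw [Finset.map_sdiff, Finset.map_sdiff, Finset.map_union] at this
      simpa [Finset.map_insert] using this
    · simpa only [← Finset.map_inter, ← Finset.map_sdiff, Finset.card_map] using hh

lemma aux_inter {t D E : Finset β} (h : ∀ p ∈ t, p ∉ E) : t ∩ (D ∪ E) = t ∩ D := by
  ext p
  simp only [Finset.mem_inter, Finset.mem_union]
  have := h p
  tauto

lemma aux_sdiff {t D E : Finset β} (h : ∀ p ∈ t, p ∉ E) : (D ∪ E) \ t = (D \ t) ∪ E := by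
  ext p
  simp only [Finset.mem_sdiff, Finset.mem_union]
  have := h p
  tauto

lemma Shp_union {U W : Finset α} (hd : Disjoint U W) {u v : ℕ} {δ ε : ℤ}
    {D M D' M' : Finset (Finset α)} (h : Shp U u δ D M)
    (hsub : ∀ p ∈ D ∪ M, p ⊆ U)
    (h' : IsPerfectMatchingOn W (D' ∪ M'))
    (hv : (v : ℤ) = u + 2 * D'.card + 2 * M'.card)
    (he : ε = δ + D'.card - M'.card) :
    Shp (U ∪ W) v ε (D ∪ D') (M ∪ M') := by
  have key : ∀ p, p ∈ D ∪ M → p ∈ D' ∪ M' → p.card = 2 → False := by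
    intro p hp hp' h2
    have h3 : p ⊆ U ∩ W := Finset.subset_inter (hsub p hp) (h'.1 p hp').2
    rw [Finset.disjoint_iff_inter_eq_empty.1 hd] at h3
    have := Finset.card_le_card h3
    simp at this
    simp [this] at h2
  have key2 : ∀ p, p ∈ D ∪ M → p ∈ D' ∪ M' → False := fun p hp hp' =>
    key p hp hp' (h'.1 p hp').1
  have dD : Disjoint D D' := Finset.disjoint_left.2 fun p h1 h2 =>
    key2 p (Finset.mem_union_left _ h1) (Finset.mem_union_left _ h2)
  have dM : Disjoint M M' := Finset.disjoint_left.2 fun p h1 h2 =>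
    key2 p (Finset.mem_union_right _ h1) (Finset.mem_union_right _ h2)
  have cD := Finset.card_union_of_disjoint dD
  have cM := Finset.card_union_of_disjoint dM
  have hcomm : D ∪ D' ∪ (M ∪ M') = (D ∪ M) ∪ (D' ∪ M') := by
    exact Finset.union_union_union_comm D D' M M'
  rcases h with ⟨h0, h1, h2, h3⟩ | ⟨h0, c, a₂, a₃, a₄, star, hc, h2, h3, h4, n1, n2, n3, n4, n5, n6,
    hst, hsubs, hpm, hh⟩
  · left
    refine ⟨by omega, ?_, by omega, by omega⟩
    rw [hcomm]
    exact pm_union hd h1 h'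
  · right
    have sD : ∀ p ∈ star, p ∉ D' := fun p hp hp' =>
      key2 p (hsubs hp) (Finset.mem_union_left _ hp')
    have sM : ∀ p ∈ star, p ∉ M' := fun p hp hp' =>
      key2 p (hsubs hp) (Finset.mem_union_right _ hp')
    have i1 : star ∩ (D ∪ D') = star ∩ D := aux_inter sD
    have i2 : star ∩ (M ∪ M') = star ∩ M := aux_inter sM
    have i3 : (D ∪ D') \ star = (D \ star) ∪ D' := aux_sdiff sD
    have i4 : (M ∪ M') \ star = (M \ star) ∪ M' := aux_sdiff sM
    have c3 : ((D \ star) ∪ D').card = (D \ star).card + D'.card :=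
      Finset.card_union_of_disjoint (dD.mono_left Finset.sdiff_subset)
    have c4 : ((M \ star) ∪ M').card = (M \ star).card + M'.card :=
      Finset.card_union_of_disjoint (dM.mono_left Finset.sdiff_subset)
    refine ⟨by omega, c, a₂, a₃, a₄, star, Finset.mem_union_left _ hc,
      Finset.mem_union_left _ h2, Finset.mem_union_left _ h3, Finset.mem_union_left _ h4,
      n1, n2, n3, n4, n5, n6, hst, ?_, ?_, ?_⟩
    · rw [hcomm]; exact hsubs.trans Finset.subset_union_left
    · have e1 : (D ∪ D' ∪ (M ∪ M')) \ star = ((D ∪ M) \ star) ∪ (D' ∪ M') := by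
        rw [hcomm]
        apply aux_sdiff
        intro p hp hp'
        exact key2 p (hsubs hp) hp'
      have e2 : (U ∪ W) \ {c, a₂, a₃, a₄} = (U \ {c, a₂, a₃, a₄}) ∪ W := by
        have hsU : ({c, a₂, a₃, a₄} : Finset α) ⊆ U := by
          intro x hx
          simp only [Finset.mem_insert, Finset.mem_singleton] at hx
          rcases hx with rfl | rfl | rfl | rfl <;> assumption
        exact aux_sdiff fun x hx => Finset.disjoint_left.1 hd (hsU hx)
      rw [e1, e2]
      exact pm_union (hd.mono_left Finset.sdiff_subset) hpm h'
    · rw [i1, i2, i3, i4, c3, c4]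
      push_cast
      rcases hh with ⟨g1, g2, g3, g4⟩ | ⟨g1, g2, g3, g4⟩
      · left; exact ⟨g1, g2, by omega, by omega⟩
      · right; exact ⟨g1, g2, by omega, by omega⟩


/-- Uniqueness of the first component of the associated pair. -/
lemma assoc_unique {v b : ℕ} {l l' : ℕ} {e e' : ℤ} (hv : 3 ≤ v)
    (h : AssocPair v b l e) (h' : AssocPair v b l' e') : l = l' ∧ e = e' := by
  obtain ⟨h1, h2, h3⟩ := h
  obtain ⟨h1', h2', h3'⟩ := h'
  have hv' : (3 : ℤ) ≤ v := by exact_mod_cast hv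
  have key : ((l : ℤ) - l') * (v * ((v : ℤ) - 1)) = 2 * e' - 2 * e := by linarith
  have hl : (l : ℤ) = l' := by
    rcases lt_trichotomy (l : ℤ) l' with hlt | heq | hgt
    · have h4 : (1 : ℤ) ≤ l' - l := by omega
      have h5 : 1 * (v * ((v : ℤ) - 1)) ≤ ((l' : ℤ) - l) * (v * ((v : ℤ) - 1)) :=
        mul_le_mul_of_nonneg_right h4 (by nlinarith)
      nlinarith
    · exact heq
    · have h4 : (1 : ℤ) ≤ l - l' := by omega
      have h5 : 1 * (v * ((v : ℤ) - 1)) ≤ ((l : ℤ) - l') * (v * ((v : ℤ) - 1)) :=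
        mul_le_mul_of_nonneg_right h4 (by nlinarith)
      nlinarith
  refine ⟨by exact_mod_cast hl, ?_⟩
  rw [hl] at h1
  linarith

/-- Under (C1) with an even number of points, the associated index is even. -/
lemma not_C1 {v b l : ℕ} {e : ℤ} (hv : 6 ≤ v) (hv2 : v % 2 = 0) (hl : l % 2 = 1)
    (h : AssocPair v b l e) : ¬ CondC1 v b := by
  rintro ⟨hv3, l', hl', hcase, hb⟩
  rcases hcase with ⟨h5, _⟩ | ⟨h2, hl2⟩
  · omega
  · have hcast : ((l' * v * (v - 1) : ℕ) : ℤ) = (l' : ℤ) * v * ((v : ℤ) - 1) := by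
      rw [Nat.cast_mul, Nat.cast_mul, Nat.cast_sub (by omega)]; simp
    obtain ⟨k, hk⟩ : ∃ k, k = l' * v * (v - 1) := ⟨_, rfl⟩
    have hkev : k % 2 = 0 := by
      rw [hk, Nat.mul_mod, Nat.mul_mod l' v, hv2]; simp
    rw [← hk] at hb hcast
    have h' : ∃ e', AssocPair v b l' e' := by
      refine ⟨(6 * (b : ℤ) - k) / 2, ?_⟩
      unfold AssocPair
      rw [← hcast]
      rcases hb with hb | hb <;> (refine ⟨?_, ?_, ?_⟩ <;> omega)
    obtain ⟨e', he'⟩ := h'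
    have := (assoc_unique (by omega) h he').1
    omega

/-- A 3-balanced system with fewer blocks than triples is simple. -/
lemma simple_of_balanced {X : Finset α} {F : Multiset (Finset α)}
    (h : ∀ B ∈ F, B.card = 3 ∧ B ⊆ X) (hb : ThreeBalancedOn X F)
    (hc : Multiset.card F < X.card.choose 3) : ∀ T, F.count T ≤ 1 := by
  intro T
  by_contra hT
  push Not at hT
  have hTm : T ∈ F := Multiset.count_pos.1 (by omega)
  have hTX : T ∈ X.powersetCard 3 := Finset.mem_powersetCard.2 ⟨(h T hTm).2, (h T hTm).1⟩
  have h1 : ∀ T' ∈ X.powersetCard 3, 1 ≤ F.count T' := by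
    intro T' hT'
    have := hb T hTX T' hT'
    omega
  have h2 : ∑ T' ∈ X.powersetCard 3, F.count T' = Multiset.card F := by
    apply Multiset.sum_count_eq_card
    intro B hB
    exact Finset.mem_powersetCard.2 ⟨(h B hB).2, (h B hB).1⟩
  have h3 := Finset.sum_le_sum h1
  rw [h2, Finset.sum_const, Finset.card_powersetCard] at h3
  simp at h3
  omega

/-- An embedding onto a prescribed set. -/
lemma exists_emb {u : ℕ} {W : Finset α} (hW : W.card = u) :
    ∃ f : Fin u ↪ α, Finset.univ.map f = W := by
  subst hW
  refine ⟨(W.equivFin.symm.toEmbedding).trans (Function.Embedding.subtype _), ?_⟩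
  ext x
  simp only [Finset.mem_map, Finset.mem_univ, true_and]
  constructor
  · rintro ⟨i, rfl⟩
    exact (W.equivFin.symm i).2
  · intro hx
    exact ⟨W.equivFin ⟨x, hx⟩, by simp⟩

/-- An embedding onto a prescribed set, taking a prescribed subset to a prescribed subset. -/
lemma exists_emb' {u : ℕ} {W S : Finset α} (hW : W.card = u) (hS : S ⊆ W)
    {Y : Finset (Fin u)} (hY : Y.card = S.card) :
    ∃ f : Fin u ↪ α, Finset.univ.map f = W ∧ Y.map f = S := by
  classical
  obtain ⟨f, hf⟩ := exists_emb hW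
  obtain ⟨Z, hZ⟩ : ∃ Z : Finset (Fin u), Z.map f = S := by
    rw [← hf] at hS
    obtain ⟨Z, _, hZ⟩ := Finset.subset_map_iff.1 hS
    exact ⟨Z, hZ.symm⟩
  have hc : Y.card = Z.card := by rw [hY, ← hZ, Finset.card_map]
  let e : {x // x ∈ Y} ≃ {x // x ∈ Z} := Finset.equivOfCardEq hc
  let σ : Equiv.Perm (Fin u) := e.extendSubtype
  refine ⟨σ.toEmbedding.trans f, ?_, ?_⟩
  · rw [← Finset.map_map, Finset.map_univ_equiv, hf]
  · rw [← Finset.map_map, ← hZ]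
    congr 1
    apply Finset.eq_of_subset_of_card_le
    · intro x hx
      obtain ⟨y, hy, rfl⟩ := Finset.mem_map.1 hx
      exact e.extendSubtype_mem y hy
    · rw [Finset.card_map, hc]

/-- Choice of the number `r` of doubled pairs. -/
lemma exists_r {a g n s : ℕ} (hg3 : g % 3 = 0) (hg : 0 < g) (ha : 0 < a) (hn : 0 < n) (ε : ℤ)
    (hs : 2 ≤ s)
    (h1 : -(2 * (a : ℤ) * g * n + s) < 2 * ε) (h2 : 2 * ε < 2 * (a : ℤ) * g * n + s) :
    ∃ r : ℕ, r ≤ a * g * (n - 1) ∧ 3 * a ∣ r ∧ ∃ δ : ℤ, 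
      δ = ε + (a * g * (n - 1) : ℕ) - 2 * r ∧
      -(2 * (a : ℤ) * g + s) < 2 * δ ∧ 2 * δ < 2 * (a : ℤ) * g + s := by
  obtain ⟨k, rfl⟩ : ∃ k, g = 3 * k := ⟨g / 3, by omega⟩
  obtain ⟨m, rfl⟩ : ∃ m, n = m + 1 := ⟨n - 1, by omega⟩
  have hk : 0 < k := by omega
  simp only [Nat.add_sub_cancel]
  have hak : a ≤ a * k := Nat.le_mul_of_pos_right a hk
  obtain ⟨w, hw⟩ : ∃ w, w = a * k := ⟨_, rfl⟩
  obtain ⟨N, hN⟩ : ∃ N, N = k * m := ⟨_, rfl⟩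
  have e1 : a * (3 * k) * m = 3 * a * N := by rw [hN]; ring
  have e2 : 2 * (a : ℤ) * ((3 * k : ℕ) : ℤ) * ((m + 1 : ℕ) : ℤ) = 6 * (a * N : ℕ) + 6 * w := by
    rw [hN, hw]; push_cast; ring
  have e3 : 2 * (a : ℤ) * ((3 * k : ℕ) : ℤ) = 6 * w := by rw [hw]; push_cast; ring
  rw [e2] at h1 h2
  rw [e1, e3]
  rw [← hw] at hak
  -- find the least j with upper bound satisfied
  have hex : ∃ j : ℕ, 2 * (ε + (3 * (a * N) : ℕ) - 6 * (a * j : ℕ)) < 6 * (w : ℤ) + s := by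
    refine ⟨N, ?_⟩
    push_cast at *
    linarith
  classical
  let j := Nat.find hex
  have hj : 2 * (ε + (3 * (a * N) : ℕ) - 6 * (a * j : ℕ)) < 6 * (w : ℤ) + s := Nat.find_spec hex
  have hjN : j ≤ N := by
    apply Nat.find_min'
    push_cast at *
    linarith
  refine ⟨3 * a * j, Nat.mul_le_mul_left _ hjN, Dvd.intro j rfl, _, rfl, ?_, ?_⟩
  · rcases Nat.eq_zero_or_pos j with hj0 | hj0
    · rw [hj0]
      push_cast at *
      linarith
    · have hm : ¬ 2 * (ε + (3 * (a * N) : ℕ) - 6 * (a * (j - 1) : ℕ)) < 6 * (w : ℤ) + s :=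
        Nat.find_min hex (Nat.sub_lt hj0 one_pos)
      obtain ⟨i, hi⟩ : ∃ i, j = i + 1 := ⟨j - 1, by omega⟩
      rw [hi] at hm ⊢
      rw [Nat.add_sub_cancel] at hm
      have hak' : (a : ℤ) ≤ w := by exact_mod_cast hak
      have hs' : (2 : ℤ) ≤ s := by exact_mod_cast hs
      push_cast at *
      nlinarith
  · push_cast at *
    linarith

lemma gdd_zero {X : Finset α} {mu u : ℕ} {W : Finset α} {B : Multiset (Finset α)}
    (h : IsGDD1u X mu u W B) {p : Finset α} (hp : p.card = 2) (hpW : p ⊆ W) :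
    lamF B p = 0 := by
  apply lamF_eq_zero
  intro A hA hpA
  have h1 := (h.2.2.1 A hA).2.2
  have h2 := Finset.card_le_card (Finset.subset_inter hpA hpW)
  omega

lemma lamF_map_zero {u : ℕ} (f : Fin u ↪ α) (F : Multiset (Finset (Fin u))) {p : Finset α}
    (hp : ¬ p ⊆ Finset.univ.map f) : lamF (F.map (fmap f)) p = 0 := by
  apply lamF_eq_zero
  intro A hA hpA
  obtain ⟨A', _, rfl⟩ := Multiset.mem_map.1 hA
  exact hp (hpA.trans (Finset.map_subset_map.2 (Finset.subset_univ _)))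

lemma exists_preim {u : ℕ} (f : Fin u ↪ α) {p : Finset α} (hp : p ⊆ Finset.univ.map f) :
    ∃ p' : Finset (Fin u), p = p'.map f := by
  obtain ⟨Z, _, hZ⟩ := Finset.subset_map_iff.1 hp
  exact ⟨Z, hZ⟩

/-- Three doubled group divisible designs plus a design on the long group form an index 6 design. -/
lemma comp6 {X : Finset α} {u : ℕ} {W : Finset α} {ι : Type*} (T : Finset ι) (hT : T.card = 3)
    (P : ι → Multiset (Finset α)) (hP : ∀ i ∈ T, IsGDD1u X 2 u W (P i))
    (f : Fin u ↪ α) (hf : Finset.univ.map f = W) {B : Multiset (Finset (Fin u))}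
    (hB : IsSDesignOn Finset.univ 6 B) {p : Finset α} (hp : p ∈ X.powersetCard 2) :
    lamF (∑ i ∈ T, P i) p + lamF (B.map (fmap f)) p = 6 := by
  have hp2 := (Finset.mem_powersetCard.1 hp).2
  rw [lamF_sum]
  by_cases hpW : p ⊆ W
  · rw [Finset.sum_eq_zero fun i hi => gdd_zero (hP i hi) hp2 hpW]
    obtain ⟨p', rfl⟩ := exists_preim f (hf ▸ hpW)
    rw [lamF_map, hB.2 p' (Finset.mem_powersetCard.2 ⟨Finset.subset_univ _, by simpa using hp2⟩)]
  · rw [Finset.sum_congr rfl fun i hi => (hP i hi).2.2.2 p hp hpW,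
      lamF_map_zero f B (by rwa [hf])]
    simp [hT]

lemma count_map_le {u : ℕ} (f : Fin u ↪ α) {F : Multiset (Finset (Fin u))}
    (h : F.Nodup) (T : Finset α) : (F.map (fmap f)).count T ≤ 1 :=
  Multiset.nodup_iff_count_le_one.1 (h.map (fmap f).injective) T

end Helpers

set_option maxHeartbeats 4000000 in
/-- Construction via g-PCS_2^e((2ag)^n : s) (Construction tbbb). -/
theorem stmt_11 (a g n s lam : ℕ)
    (hg3 : g % 3 = 0) (hs : s % 6 = 2 ∨ s % 6 = 4)
    (hlam : lam = 1 ∨ lam = 3 ∨ lam = 5) (ha : 0 < a) (hn : 0 < n)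
    (hPCS : ∀ e : ℕ, e ≤ a * g * (n - 1) → (3 * a) ∣ e →
      ∃ (S : Finset (Fin (2 * a * g * n + s)))
        (G : Fin n → Finset (Fin (2 * a * g * n + s)))
        (A : Multiset (Finset (Fin (2 * a * g * n + s)))),
        IsGPCS2r Finset.univ a g n s e S G A)
    (hS6 : ∃ Y : Finset (Fin (2 * a * g + s)), Y.card = s ∧
      ∃ B : Multiset (Finset (Fin (2 * a * g + s))),
        B.Nodup ∧ IsSDesignOn Finset.univ 6 B ∧ ∀ A ∈ B, ¬ A ⊆ Y)
    (hNW : ∀ (c : ℕ) (δ : ℤ),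
      -(2 * (a : ℤ) * g + s) < 2 * δ → 2 * δ < 2 * (a : ℤ) * g + s →
      3 * (c : ℤ) = (lam : ℤ) * ((2 * a * g + s).choose 2 : ℤ) + δ →
      ∃ F : Multiset (Finset (Fin (2 * a * g + s))),
        IsNWBTSOn Finset.univ (2 * a * g + s) c F) :
    ∀ q : ℕ, q ≤ n - 1 → ∀ (b' : ℕ) (ε : ℤ),
      -(2 * (a : ℤ) * g * n + s) < 2 * ε → 2 * ε < 2 * (a : ℤ) * g * n + s →
      3 * (b' : ℤ) = (lam : ℤ) * ((2 * a * g * n + s).choose 2 : ℤ) + ε →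
      ∃ F : Multiset (Finset (Fin (2 * a * g * n + s))),
        IsNWBTSOn Finset.univ (2 * a * g * n + s)
          (q * ((2 * a * g * n + s) * (2 * a * g * n + s - 1)) + b') F := by
  have hg : 0 < g := by
    obtain ⟨S, G, A, _, P, grp, _, _, _, i, _⟩ := hPCS 0 (Nat.zero_le _) (dvd_zero _)
    have := i.2
    rcases Nat.eq_zero_or_pos g with h0 | h0
    · subst h0; simp at this
    · exact h0
  have hg3' : 3 ≤ g := by omega
  have hs2 : 2 ≤ s := by omega
  intro q hq b' ε hε1 hε2 hb'
  obtain ⟨r, hr1, hr2, δ, hδ, hδ1, hδ2⟩ := exists_r hg3 hg ha hn ε hs2 hε1 hε2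
  obtain ⟨u, hu⟩ : ∃ u, u = 2 * a * g + s := ⟨_, rfl⟩
  obtain ⟨V, hV⟩ : ∃ V, V = 2 * a * g * n + s := ⟨_, rfl⟩
  obtain ⟨m, hm⟩ : ∃ m, m = a * g * (n - 1) := ⟨_, rfl⟩
  have hVu : V = u + 2 * m := by
    obtain ⟨k, rfl⟩ : ∃ k, n = k + 1 := ⟨n - 1, by omega⟩
    rw [hV, hu, hm, Nat.add_sub_cancel]; ring
  have hag : 3 ≤ a * g := le_trans hg3' (Nat.le_mul_of_pos_left g ha)
  have hu8 : 8 ≤ u := by rw [hu, mul_assoc]; omega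
  have hu2 : u % 2 = 0 := by rw [hu, mul_assoc]; omega
  have hm3 : 3 ∣ m := by
    rw [hm]
    exact Dvd.dvd.mul_right (Dvd.dvd.mul_left (Nat.dvd_of_mod_eq_zero hg3) a) _
  have hr3 : 3 ∣ r := dvd_trans (Dvd.intro a rfl) hr2
  have hu' : 2 * (a : ℤ) * g + s = u := by rw [hu]; push_cast; ring
  have hV' : 2 * (a : ℤ) * g * n + s = V := by rw [hV]; push_cast; ring
  specialize hPCS r hr1 hr2
  unfold IsGPCS2r at hPCS
  rw [hu'] at hδ1 hδ2 hNW
  rw [hV'] at hε1 hε2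
  rw [← hm] at hδ hr1 hPCS
  rw [← hV] at hPCS hb' ⊢
  rw [← hu] at hPCS hS6 hNW
  -- the block number of the small system
  have tu := two_choose_two u
  have tV := two_choose_two V
  have hlam1 : (lam : ℤ) ≤ 5 ∧ 1 ≤ (lam : ℤ) := by omega
  obtain ⟨c, hc⟩ : ∃ c : ℕ, 3 * (c : ℤ) = (lam : ℤ) * (u.choose 2 : ℤ) + δ := by
    obtain ⟨m', rfl⟩ := hm3
    obtain ⟨r', rfl⟩ := hr3
    have e1 : (V.choose 2 : ℤ) = (u.choose 2 : ℤ) + 3 * (m' * (2 * u + 6 * m' - 1)) := by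
      have : (V : ℤ) = u + 6 * m' := by rw [hVu]; push_cast; ring
      rw [this] at tV
      have h2 : 2 * (V.choose 2 : ℤ) =
          2 * ((u.choose 2 : ℤ) + 3 * (m' * (2 * u + 6 * m' - 1))) := by
        linear_combination tV - tu
      linarith
    have hnn : 0 ≤ (lam : ℤ) * (u.choose 2 : ℤ) + δ := by
      have h8 : (8 : ℤ) ≤ u := by exact_mod_cast hu8
      have h9 : (u : ℤ) ≤ (u.choose 2 : ℤ) := by nlinarith
      nlinarith
    obtain ⟨z, hz⟩ : ∃ z : ℤ, 3 * z = (lam : ℤ) * (u.choose 2 : ℤ) + δ := by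
      refine ⟨b' - lam * (m' * (2 * u + 6 * m' - 1)) + m' - 2 * r', ?_⟩
      rw [hδ]
      rw [e1] at hb'
      push_cast
      linarith
    refine ⟨z.toNat, ?_⟩
    rw [Int.toNat_of_nonneg (by linarith)]
    exact hz
  obtain ⟨F', hF'⟩ := hNW c δ hδ1 hδ2 hc
  obtain ⟨⟨_, hF'card, hF'blk⟩, hF'bal, l, e, _, hassoc, hrange, hshape⟩ := hF'
  have hassoc' : AssocPair u c lam δ := by
    refine ⟨?_, hδ1, hδ2⟩
    linear_combination 2 * hc + (lam : ℤ) * tu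
  obtain ⟨rfl, rfl⟩ := assoc_unique (by omega) hassoc' hassoc
  have hnC1 := not_C1 (by omega) hu2 (by omega) hassoc'
  have hshape' : Shp Finset.univ u δ (Dlev Finset.univ F' lam 1) (Dlev Finset.univ F' lam (-1)) := by
    rcases hshape with h | h
    · exact absurd h.1 hnC1
    · exact h.2
  have hF'simple : F'.Nodup := by
    rw [Multiset.nodup_iff_count_le_one]
    apply simple_of_balanced hF'blk hF'bal
    rw [hF'card, Finset.card_univ, Fintype.card_fin]
    have h3 := six_choose_three u
    have h8 : (8 : ℤ) ≤ u := by exact_mod_cast hu8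
    have h6 := hassoc'.1
    have h7 : (lam : ℤ) * u * ((u : ℤ) - 1) ≤ 5 * u * ((u : ℤ) - 1) := by
      apply mul_le_mul_of_nonneg_right _ (by linarith)
      exact mul_le_mul_of_nonneg_right hlam1.1 (by linarith)
    have h10 : 6 * (u * ((u : ℤ) - 1)) ≤ u * ((u : ℤ) - 1) * (u - 2) := by
      rw [mul_comm]
      exact mul_le_mul_of_nonneg_left (by linarith) (mul_nonneg (by linarith) (by linarith))
    have h11 : (u : ℤ) * 1 ≤ u * ((u : ℤ) - 1) :=
      mul_le_mul_of_nonneg_left (by linarith) (by linarith)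
    have : (c : ℤ) < (u.choose 3 : ℤ) := by linarith
    exact_mod_cast this
  obtain ⟨Y, hY, B6, hB6n, hB6, hB6Y⟩ := hS6
  obtain ⟨S, G, A, hCS, P, grp, hPA, hgrp, hGDD, i0, N, Gs, hNP, hN⟩ := hPCS
  obtain ⟨hScard, _, hGcard, hGdisj, hGS, hX, hAblk, hA1, hA0⟩ := hCS
  obtain ⟨hGs2, hUcard, _, hGsdisj, hGsU, hUX, hNblk, hN2, hN0, hNU, hN1⟩ := hN
  -- embeddings
  have hWcard : ∀ j, (G j ∪ S).card = u := by
    intro j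
    rw [Finset.card_union_of_disjoint (hGS j), (hGcard j).1, hScard, hu]
  have hemb : ∀ j, ∃ f : Fin u ↪ Fin V, Finset.univ.map f = G j ∪ S ∧ Y.map f = S := fun j =>
    exists_emb' (hWcard j) Finset.subset_union_right (by rw [hY, hScard])
  choose f hf hfY using hemb
  obtain ⟨j0, hj0⟩ : ∃ j0, j0 = grp i0 := ⟨_, rfl⟩
  rw [← hj0] at hUcard hGsU hUX hNU hN1
  -- index sets
  have hT : ∀ j : Fin n, ∃ T ⊆ Finset.univ.filter (fun i => grp i = j), T.card = 3 := fun j =>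
    Finset.exists_subset_card_eq (by rw [hgrp j]; exact hg3')
  choose T hTsub hTcard using hT
  obtain ⟨k, hk, hk2⟩ : ∃ k, lam = 2 * k + 1 ∧ k ≤ 2 := ⟨lam / 2, by omega, by omega⟩
  obtain ⟨K, hKsub, hKcard⟩ : ∃ K ⊆ (Finset.univ.filter (fun i => grp i = j0)).erase i0,
      K.card = k := by
    apply Finset.exists_subset_card_eq
    rw [Finset.card_erase_of_mem (by simp [hj0]), hgrp]
    omega
  obtain ⟨J, hJsub, hJcard⟩ : ∃ J ⊆ (Finset.univ : Finset (Fin n)).erase j0, J.card = q := by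
    apply Finset.exists_subset_card_eq
    rw [Finset.card_erase_of_mem (Finset.mem_univ _), Finset.card_univ, Fintype.card_fin]
    exact hq
  have hTgrp : ∀ j, ∀ i ∈ T j, grp i = j := fun j i hi => (Finset.mem_filter.1 (hTsub j hi)).2
  have hKgrp : ∀ i ∈ K, grp i = j0 := fun i hi =>
    (Finset.mem_filter.1 (Finset.mem_of_mem_erase (hKsub hi))).2
  have hKi0 : i0 ∉ K := fun h => (Finset.mem_erase.1 (hKsub h)).1 rfl
  have hJj0 : j0 ∉ J := fun h => (Finset.mem_erase.1 (hJsub h)).1 rfl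
  -- the system
  obtain ⟨F, hF⟩ : ∃ F : Multiset (Finset (Fin V)), F = F'.map (fmap (f j0)) + N +
      (∑ i ∈ K, P i) + ∑ j ∈ J, ((∑ i ∈ T j, P i) + B6.map (fmap (f j))) := ⟨_, rfl⟩
  have hFlam : ∀ p ∈ (Finset.univ : Finset (Fin V)).powersetCard 2,
      lamF F p = lamF (F'.map (fmap (f j0))) p + lamF N p + (∑ i ∈ K, lamF (P i) p) + 6 * q := by
    intro p hp
    rw [hF, lamF_add, lamF_add, lamF_add, lamF_sum, lamF_sum]
    congr 1
    rw [Finset.sum_congr rfl fun j _ => (by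
      rw [lamF_add]
      exact comp6 (T j) (hTcard j) P (fun i hi => by
        have := hGDD i
        rwa [hTgrp j i hi] at this) (f j) (hf j) hB6 hp :
        lamF ((∑ i ∈ T j, P i) + B6.map (fmap (f j))) p = 6)]
    rw [Finset.sum_const, hJcard, smul_eq_mul, mul_comm]
  have hFin : ∀ p' ∈ (Finset.univ : Finset (Fin u)).powersetCard 2,
      lamF F (p'.map (f j0)) = lamF F' p' + 6 * q := by
    intro p' hp'
    have hc2 : (p'.map (f j0)).card = 2 := by
      rw [Finset.card_map]; exact (Finset.mem_powersetCard.1 hp').2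
    have hsub : p'.map (f j0) ⊆ G j0 ∪ S := by
      rw [← hf j0]; exact Finset.map_subset_map.2 (Finset.subset_univ _)
    rw [hFlam _ (Finset.mem_powersetCard.2 ⟨Finset.subset_univ _, hc2⟩), lamF_map,
      hNU _ (Finset.mem_powersetCard.2 ⟨hsub, hc2⟩),
      Finset.sum_eq_zero fun i hi =>
        gdd_zero (hGDD i) hc2 (by rw [hKgrp i hi]; exact hsub), add_zero, add_zero]
  have hFout : ∀ p ∈ (Finset.univ : Finset (Fin V)).powersetCard 2, ¬ p ⊆ G j0 ∪ S →
      lamF F p + 1 = lamF N p + (6 * q + lam) := by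
    intro p hp hpU
    rw [hFlam p hp, lamF_map_zero (f j0) F' (by rwa [hf]),
      Finset.sum_congr rfl fun i hi => (hGDD i).2.2.2 p hp (by rw [hKgrp i hi]; exact hpU),
      Finset.sum_const, hKcard, smul_eq_mul]
    omega
  -- blocks
  have hPblk : ∀ i, ∀ B ∈ P i, B.card = 3 := fun i B hB => ((hGDD i).2.2.1 B hB).1
  have hFblk : ∀ B ∈ F, B.card = 3 := by
    intro B hB
    rw [hF] at hB
    simp only [Multiset.mem_add, Multiset.mem_sum] at hB
    rcases hB with ((hB | hB) | ⟨i, _, hB⟩) | ⟨j, _, ⟨i, _, hB⟩ | hB⟩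
    · obtain ⟨B', hB', rfl⟩ := Multiset.mem_map.1 hB
      rw [fmap_apply, Finset.card_map]; exact (hF'blk B' hB').1
    · exact (hNblk B hB).1
    · exact hPblk i B hB
    · exact hPblk i B hB
    · obtain ⟨B', hB', rfl⟩ := Multiset.mem_map.1 hB
      rw [fmap_apply, Finset.card_map]; exact (hB6.1 B' hB').1
  have hcount : ∀ Z, F.count Z ≤ 1 := by
    intro Z
    by_cases hZ3 : Z.card = 3
    swap
    · rw [Multiset.count_eq_zero_of_notMem fun h => hZ3 (hFblk Z h)]; exact zero_le_one
    have hZm : Z ∈ (Finset.univ : Finset (Fin V)).powersetCard 3 :=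
      Finset.mem_powersetCard.2 ⟨Finset.subset_univ _, hZ3⟩
    have hAc : lamF A Z = A.count Z := lamF_eq_count (fun B hB => (hAblk B hB).1) hZ3
    have hbr : N.count Z + (∑ i ∈ K, (P i).count Z) + ∑ j ∈ J, ∑ i ∈ T j, (P i).count Z
        ≤ A.count Z := by
      have d1 : Disjoint K (J.biUnion T) := by
        rw [Finset.disjoint_left]
        intro i hi hi'
        obtain ⟨j, hj, hij⟩ := Finset.mem_biUnion.1 hi'
        have e1 := hKgrp i hi
        rw [hTgrp j i hij] at e1
        exact hJj0 (e1 ▸ hj)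
      have d2 : i0 ∉ K ∪ J.biUnion T := by
        rw [Finset.mem_union]
        rintro (h | h)
        · exact hKi0 h
        · obtain ⟨j, hj, hij⟩ := Finset.mem_biUnion.1 h
          have e1 := hTgrp j i0 hij
          rw [← hj0] at e1
          exact hJj0 (e1 ▸ hj)
      have d3 : ((J : Set (Fin n))).PairwiseDisjoint T := by
        intro j _ j' _ hjj'
        change Disjoint (T j) (T j')
        rw [Finset.disjoint_left]
        intro i hi hi'
        exact hjj' ((hTgrp j i hi).symm.trans (hTgrp j' i hi'))
      have e1 : ∑ i ∈ insert i0 (K ∪ J.biUnion T), (P i).count Z =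
          (P i0).count Z + ((∑ i ∈ K, (P i).count Z) + ∑ j ∈ J, ∑ i ∈ T j, (P i).count Z) := by
        rw [Finset.sum_insert d2, Finset.sum_union d1, Finset.sum_biUnion d3]
      have e2 : ∑ i ∈ insert i0 (K ∪ J.biUnion T), (P i).count Z ≤ ∑ i, (P i).count Z :=
        Finset.sum_le_sum_of_subset (Finset.subset_univ _)
      have e3 := Multiset.le_iff_count.1 hPA Z
      rw [Multiset.count_sum'] at e3
      have e4 := Multiset.le_iff_count.1 hNP Z
      omega
    have hFc : F.count Z = (F'.map (fmap (f j0))).count Z +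
        (∑ j ∈ J, (B6.map (fmap (f j))).count Z) +
        (N.count Z + (∑ i ∈ K, (P i).count Z) + ∑ j ∈ J, ∑ i ∈ T j, (P i).count Z) := by
      rw [hF]
      simp only [Multiset.count_add, Multiset.count_sum', Finset.sum_add_distrib]
      ring
    have hB6c : ∀ j, (B6.map (fmap (f j))).count Z ≠ 0 → Z ⊆ G j ∪ S ∧ ¬ Z ⊆ S := by
      intro j h
      obtain ⟨B', hB', rfl⟩ := Multiset.mem_map.1 (Multiset.count_ne_zero.1 h)
      refine ⟨?_, ?_⟩
      · rw [← hf j]; exact Finset.map_subset_map.2 (Finset.subset_univ _)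
      · rw [← hfY j]
        exact fun h => hB6Y B' hB' (Finset.map_subset_map.1 h)
    have hF'c : (F'.map (fmap (f j0))).count Z ≠ 0 → Z ⊆ G j0 ∪ S := by
      intro h
      obtain ⟨B', hB', rfl⟩ := Multiset.mem_map.1 (Multiset.count_ne_zero.1 h)
      rw [← hf j0]; exact Finset.map_subset_map.2 (Finset.subset_univ _)
    have huniq : ∀ j j', Z ⊆ G j ∪ S → Z ⊆ G j' ∪ S → ¬ Z ⊆ S → j = j' := by
      intro j j' h1 h2 h3
      by_contra hne
      apply h3
      intro x hx
      rcases Finset.mem_union.1 (h1 hx) with h | h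
      · rcases Finset.mem_union.1 (h2 hx) with h' | h'
        · exact absurd h' (Finset.disjoint_left.1 (hGdisj j j' hne) h)
        · exact h'
      · exact h
    rw [hFc]
    by_cases hex : ∃ j, Z ⊆ S ∪ G j
    · have h0 := hA0 Z hZm hex
      rw [hAc] at h0
      rw [h0] at hbr
      have hF1 := count_map_le (f j0) hF'simple Z
      by_cases hZ0 : Z ⊆ G j0 ∪ S
      · have : ∑ j ∈ J, (B6.map (fmap (f j))).count Z = 0 := by
          apply Finset.sum_eq_zero
          intro j hj
          by_contra hne
          obtain ⟨h1, h2⟩ := hB6c j hne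
          exact hJj0 ((huniq j j0 h1 hZ0 h2) ▸ hj)
        omega
      · have h1 : (F'.map (fmap (f j0))).count Z = 0 := by
          by_contra hne
          exact hZ0 (hF'c hne)
        have h2 : ∑ j ∈ J, (B6.map (fmap (f j))).count Z ≤ 1 := by
          by_cases hall : ∀ j ∈ J, (B6.map (fmap (f j))).count Z = 0
          · rw [Finset.sum_eq_zero hall]; exact zero_le_one
          · push Not at hall
            obtain ⟨j, hj, hne⟩ := hall
            obtain ⟨h3, h4⟩ := hB6c j hne
            rw [Finset.sum_eq_single_of_mem j hj]
            · exact count_map_le (f j) hB6n Z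
            · intro j' _ hjj'
              by_contra hne'
              exact hjj' (huniq j' j (hB6c j' hne').1 h3 h4)
        omega
    · have h1 := hA1 Z hZm (fun i h => hex ⟨i, h⟩)
      rw [hAc] at h1
      have h2 : (F'.map (fmap (f j0))).count Z = 0 := by
        by_contra hne
        exact hex ⟨j0, by rw [Finset.union_comm]; exact hF'c hne⟩
      have h3 : ∑ j ∈ J, (B6.map (fmap (f j))).count Z = 0 := by
        apply Finset.sum_eq_zero
        intro j _
        by_contra hne
        exact hex ⟨j, by rw [Finset.union_comm]; exact (hB6c j hne).1⟩
      omega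
  -- the defect graph
  have hGsinj : Function.Injective Gs := by
    intro i i' h
    by_contra hne
    have h1 := hGsdisj i i' hne
    rw [h, disjoint_self] at h1
    have h2 := (hGs2 i').1
    rw [h1] at h2
    simp at h2
  have hGsnU : ∀ i, ¬ Gs i ⊆ G j0 ∪ S := by
    intro i h
    have h1 := (hGsU i).mono_right h
    rw [disjoint_self] at h1
    have h2 := (hGs2 i).1
    rw [h1] at h2
    simp at h2
  have hGspair : ∀ i, Gs i ∈ (Finset.univ : Finset (Fin V)).powersetCard 2 := fun i =>
    Finset.mem_powersetCard.2 ⟨Finset.subset_univ _, (hGs2 i).1⟩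
  have hpairGs : ∀ p : Finset (Fin V), p.card = 2 → ∀ i, p ⊆ Gs i → p = Gs i := by
    intro p hp i h
    exact Finset.eq_of_subset_of_card_le h (by rw [hp, (hGs2 i).1])
  obtain ⟨M1, hM1⟩ : ∃ M1 : Finset (Finset (Fin V)),
    M1 = Finset.univ.image (fun i : Fin r => Gs (Fin.castAdd (m - r) i)) := ⟨_, rfl⟩
  obtain ⟨M2, hM2⟩ : ∃ M2 : Finset (Finset (Fin V)),
    M2 = Finset.univ.image (fun i : Fin (m - r) => Gs (Fin.natAdd r i)) := ⟨_, rfl⟩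
  have hM1card : M1.card = r := by
    rw [hM1]
    exact (Finset.card_image_of_injective _
      (hGsinj.comp (Fin.castAdd_injective _ _))).trans (by simp)
  have hM2card : M2.card = m - r := by
    rw [hM2]
    exact (Finset.card_image_of_injective _
      (hGsinj.comp (Fin.natAdd_injective _ _))).trans (by simp)
  have hM12 : ∀ p, p ∈ M1 ∪ M2 ↔ ∃ i, p = Gs i := by
    intro p
    rw [Finset.mem_union, hM1, hM2, Finset.mem_image, Finset.mem_image]
    constructor
    · rintro (⟨i, _, rfl⟩ | ⟨i, _, rfl⟩)
      · exact ⟨_, rfl⟩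
      · exact ⟨_, rfl⟩
    · rintro ⟨i, rfl⟩
      refine Fin.addCases (fun i => ?_) (fun i => ?_) i
      · exact Or.inl ⟨i, Finset.mem_univ _, rfl⟩
      · exact Or.inr ⟨i, Finset.mem_univ _, rfl⟩
  have hM1N : ∀ p ∈ M1, lamF N p = 2 := by
    intro p hp
    rw [hM1] at hp
    obtain ⟨i, _, rfl⟩ := Finset.mem_image.1 hp
    exact hN2 _ (by simp)
  have hM2N : ∀ p ∈ M2, lamF N p = 0 := by
    intro p hp
    rw [hM2] at hp
    obtain ⟨i, _, rfl⟩ := Finset.mem_image.1 hp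
    exact hN0 _ (by simp)
  have hMN : ∀ p ∈ (Finset.univ : Finset (Fin V)).powersetCard 2, ¬ p ⊆ G j0 ∪ S →
      p ∉ M1 ∪ M2 → lamF N p = 1 := by
    intro p hp hpU hpM
    apply hN1 p hp _ hpU
    intro i h
    exact hpM ((hM12 p).2 ⟨i, hpairGs p (Finset.mem_powersetCard.1 hp).2 i h⟩)
  have hMout : ∀ p ∈ M1 ∪ M2, p ∈ (Finset.univ : Finset (Fin V)).powersetCard 2 ∧
      ¬ p ⊆ G j0 ∪ S := by
    intro p hp
    obtain ⟨i, rfl⟩ := (hM12 p).1 hp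
    exact ⟨hGspair i, hGsnU i⟩
  have hpu : ∀ p' : Finset (Fin u), p' ∈ (Finset.univ : Finset (Fin u)).powersetCard 2 ↔
      p'.map (f j0) ∈ (Finset.univ : Finset (Fin V)).powersetCard 2 := by
    intro p'
    simp [Finset.mem_powersetCard]
  have hmapU : ∀ p' : Finset (Fin u), p'.map (f j0) ⊆ G j0 ∪ S := by
    intro p'
    rw [← hf j0]; exact Finset.map_subset_map.2 (Finset.subset_univ _)
  have hDgen : ∀ (z : ℤ) (M : Finset (Finset (Fin V))), M ⊆ M1 ∪ M2 →
      (∀ p ∈ (Finset.univ : Finset (Fin V)).powersetCard 2, ¬ p ⊆ G j0 ∪ S →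
        (p ∈ M ↔ (lamF N p : ℤ) = 1 + z)) →
      Dlev Finset.univ F (6 * q + lam) z =
        (Dlev Finset.univ F' lam z).map (fmap (f j0)) ∪ M := by
    intro z M hM hMz
    ext p
    unfold Dlev
    rw [Finset.mem_filter, Finset.mem_union, Finset.mem_map]
    constructor
    · rintro ⟨hp, hpz⟩
      by_cases hpU : p ⊆ G j0 ∪ S
      · left
        rw [← hf j0] at hpU
        obtain ⟨p', rfl⟩ := exists_preim _ hpU
        have hp' := (hpu p').2 hp
        refine ⟨p', Finset.mem_filter.2 ⟨hp', ?_⟩, rfl⟩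
        rw [hFin p' hp'] at hpz
        push_cast at hpz
        linarith
      · right
        rw [hMz p hp hpU]
        have := hFout p hp hpU
        push_cast at hpz
        omega
    · rintro (⟨p', hp', rfl⟩ | hpM)
      · obtain ⟨h1, h2⟩ := Finset.mem_filter.1 hp'
        refine ⟨(hpu p').1 h1, ?_⟩
        rw [fmap_apply, hFin p' h1]
        push_cast
        linarith
      · obtain ⟨h1, h2⟩ := hMout p (hM hpM)
        refine ⟨h1, ?_⟩
        have h3 := (hMz p h1 h2).1 hpM
        have := hFout p h1 h2
        push_cast
        omega
  have hD1 := hDgen 1 M1 Finset.subset_union_left (by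
    intro p hp hpU
    constructor
    · intro h; rw [hM1N p h]; norm_num
    · intro h
      by_contra hp1
      by_cases hp2 : p ∈ M2
      · rw [hM2N p hp2] at h; norm_num at h
      · rw [hMN p hp hpU (by rw [Finset.mem_union]; tauto)] at h; norm_num at h)
  have hD2 := hDgen (-1) M2 Finset.subset_union_right (by
    intro p hp hpU
    constructor
    · intro h; rw [hM2N p h]; norm_num
    · intro h
      by_contra hp2
      by_cases hp1 : p ∈ M1
      · rw [hM1N p hp1] at h; norm_num at h
      · rw [hMN p hp hpU (by rw [Finset.mem_union]; tauto)] at h; norm_num at h)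
  have hpmM : IsPerfectMatchingOn (Finset.univ.biUnion Gs) (M1 ∪ M2) := by
    refine ⟨?_, ?_⟩
    · intro p hp
      obtain ⟨i, rfl⟩ := (hM12 p).1 hp
      exact ⟨(hGs2 i).1, Finset.subset_biUnion_of_mem Gs (Finset.mem_univ i)⟩
    · intro x hx
      obtain ⟨i, _, hxi⟩ := Finset.mem_biUnion.1 hx
      refine ⟨Gs i, ⟨(hM12 _).2 ⟨i, rfl⟩, hxi⟩, ?_⟩
      rintro p ⟨hp, hxp⟩
      obtain ⟨i', rfl⟩ := (hM12 p).1 hp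
      by_contra hne
      have hne' : i' ≠ i := fun h => hne (by rw [h])
      exact Finset.disjoint_left.1 (hGsdisj i' i hne') hxp hxi
  have hdUW : Disjoint (G j0 ∪ S) (Finset.univ.biUnion Gs) := by
    rw [Finset.disjoint_biUnion_right]
    intro i _
    exact (hGsU i).symm
  have hshp : Shp Finset.univ V ε (Dlev Finset.univ F (6 * q + lam) 1)
      (Dlev Finset.univ F (6 * q + lam) (-1)) := by
    rw [hD1, hD2, ← hUX]
    have h1 := Shp_map (f j0) hshape'
    rw [hf j0] at h1
    refine Shp_union hdUW h1 ?_ hpmM ?_ ?_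
    · intro p hp
      rw [← Finset.map_union] at hp
      obtain ⟨p', _, rfl⟩ := Finset.mem_map.1 hp
      exact hmapU p'
    · rw [hM1card, hM2card, hVu]; push_cast [hr1]; ring
    · rw [hM1card, hM2card, hδ]; push_cast [hr1]; ring
  have hFrange : PairRangeOn Finset.univ F (6 * q + lam) := by
    intro p hp
    by_cases hpU : p ⊆ G j0 ∪ S
    · rw [← hf j0] at hpU
      obtain ⟨p', rfl⟩ := exists_preim _ hpU
      have hp' := (hpu p').2 hp
      have h1 := hrange p' hp'
      rw [hFin p' hp']
      push_cast
      omega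
    · have h1 := hFout p hp hpU
      have h2 : lamF N p ≤ 2 := by
        by_cases hp1 : p ∈ M1
        · rw [hM1N p hp1]
        · by_cases hp2 : p ∈ M2
          · rw [hM2N p hp2]; omega
          · rw [hMN p hp hpU (by rw [Finset.mem_union]; tauto)]; omega
      push_cast
      omega
  have hFblk' : ∀ B ∈ F, B.card = 3 ∧ B ⊆ Finset.univ := fun B hB =>
    ⟨hFblk B hB, Finset.subset_univ _⟩
  have hV1 : 1 ≤ V := by omega
  have hcardF : Multiset.card F = q * (V * (V - 1)) + b' := by
    have h1 := sum_lamF hFblk'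
    have h2 := sum_lamF_range hFrange
    have h3 := Shp_card hshp
    rw [Finset.card_univ, Fintype.card_fin] at h2
    have h4 : (3 * Multiset.card F : ℤ) = ((6 * q + lam : ℕ) : ℤ) * (V.choose 2 : ℤ) + ε := by
      have h5 : ((∑ p ∈ (Finset.univ : Finset (Fin V)).powersetCard 2, lamF F p : ℕ) : ℤ) =
        ((3 * Multiset.card F : ℕ) : ℤ) := by rw [h1]
      push_cast at h5 h2 ⊢
      linarith
    have h6 : (Multiset.card F : ℤ) = q * (V * (V - 1)) + b' := by
      push_cast at h4
      have h7 : (3 * (Multiset.card F : ℤ)) = 3 * (q * (V * (V - 1)) + b') := by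
        linear_combination h4 - hb' + 3 * (q : ℤ) * tV
      linarith
    have h8 : ((q * (V * (V - 1)) + b' : ℕ) : ℤ) = q * (V * (V - 1)) + b' := by
      push_cast [hV1]; ring
    rw [← h8] at h6
    exact_mod_cast h6
  have hassocF : AssocPair V (q * (V * (V - 1)) + b') (6 * q + lam) ε := by
    refine ⟨?_, hε1, hε2⟩
    push_cast [hV1]
    linear_combination 2 * hb' + (lam : ℤ) * tV
  refine ⟨F, ⟨by simp, hcardF, hFblk'⟩, ?_, 6 * q + lam, ε, by omega, hassocF, hFrange,
    Or.inr ⟨⟨by omega, 6 * q + lam, by omega, by omega, ?_, ?_⟩, hshp⟩⟩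
  · intro T₁ _ T₂ _
    exact (hcount T₁).trans (Nat.le_add_left _ _)
  · rw [hassocF.1]; linarith
  · rw [hassocF.1]; linarith

end DataPlacement
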